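/- arXiv:2205.06424 — 4 statements merged into one kernel-verified Lean document; each statement's English description precedes it below -/
import Mathlib

section
/- Let T > 0, let Γ ≥ 2 be an integer, and set Δt_l = T·Γ^{−l} for l ∈ ℕ. Let α, β, γ, c1, c2, c3 > 0 with 2α ≥ γ, and let (V_l)_{l≥0} and (C_l)_{l≥0} be nonnegative real sequences with V_l ≤ c2·Δt_l^β and C_l ≤ c3·Δt_l^{−γ} for all l. Then there exists a constant c4 > 0, depending only on T, Γ, α, β, γ, c1, c2, c3, such that for every δ with 0 < δ < e^{−1} there exist L ∈ ℕ and positive integers N_0, …, N_L satisfying: (i) c1·Δt_L^α ≤ δ/√2; (ii) Σ_{l=0}^{L} V_l/N_l ≤ δ²/2; and (iii) the total cost Σ_{l=0}^{L} N_l·C_l is at most c4·δ^{−2} if β > γ, at most c4·δ^{−2}·(log δ^{−1})² if β = γ, and at most c4·δ^{−2−(γ−β)/α} if 0 < β < γ. -/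
open Finset

/-- A power of the mesh size `T / q ^ l` is geometric in the level `l`. -/
theorem mesh_rpow {T q : ℝ} (hT : 0 < T) (hq : 0 < q) (x : ℝ) (l : ℕ) :
    (T * (q ^ l)⁻¹) ^ x = T ^ x * (q ^ (-x)) ^ l := by
  rw [Real.mul_rpow hT.le (by positivity), Real.inv_rpow (by positivity), Real.rpow_neg hq.le,
    ← Real.rpow_natCast, ← Real.rpow_mul hq.le, mul_comm (l : ℝ), Real.rpow_mul hq.le,
    Real.rpow_natCast, inv_pow]

theorem geom_sum_le_mul_pow {x : ℝ} (hx : 1 < x) (L : ℕ) :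
    ∑ l ∈ range (L + 1), x ^ l ≤ x / (x - 1) * x ^ L := by
  have h : 0 < x - 1 := by linarith
  rw [geom_sum_eq hx.ne', div_mul_eq_mul_div, pow_succ']
  gcongr
  linarith

/-- The least power of `r` above `M / δ` is at most `(1 + r * M) / δ`. -/
theorem exists_pow_ge_and_le {r M δ : ℝ} (hr : 1 < r) (hM : 0 < M) (hδ : 0 < δ) (hδ1 : δ < 1) :
    ∃ L : ℕ, M / δ ≤ r ^ L ∧ r ^ L ≤ (1 + r * M) / δ := by
  classical
  have hex : ∃ L : ℕ, M / δ ≤ r ^ L :=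
    (pow_unbounded_of_one_lt (M / δ) hr).imp fun _ h => h.le
  refine ⟨Nat.find hex, Nat.find_spec hex, ?_⟩
  have hrM : 0 < r * M := by positivity
  rw [le_div_iff₀ hδ]
  rcases h : Nat.find hex with _ | n
  · rw [pow_zero]
    linarith
  · have hn : r ^ n < M / δ := not_le.1 (Nat.find_min hex (h ▸ Nat.lt_succ_self n))
    rw [lt_div_iff₀ hδ] at hn
    calc r ^ (n + 1) * δ = r * (r ^ n * δ) := by ring
      _ ≤ r * M := by gcongr
      _ ≤ 1 + r * M := by linarith

theorem rpow_pow_le_of_rpow_pow_le {q α x K δ : ℝ} (hq : 0 < q) (hα : 0 < α) (hx : 0 ≤ x)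
    (hK : 0 < K) (hδ : 0 < δ) {L : ℕ} (h : (q ^ α) ^ L ≤ K / δ) :
    (q ^ x) ^ L ≤ K ^ (x / α) * δ ^ (-(x / α)) := by
  have hxα : 0 ≤ x / α := by positivity
  calc (q ^ x) ^ L = ((q ^ α) ^ L) ^ (x / α) := by
        rw [← Real.rpow_natCast, ← Real.rpow_natCast, ← Real.rpow_mul hq.le,
          ← Real.rpow_mul hq.le, ← Real.rpow_mul hq.le]
        congr 1
        field_simp
    _ ≤ (K / δ) ^ (x / α) := Real.rpow_le_rpow (by positivity) h hxα
    _ = K ^ (x / α) * δ ^ (-(x / α)) := by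
        rw [Real.div_rpow hK.le hδ.le, Real.rpow_neg hδ.le, div_eq_mul_inv]

/-- Near-optimal allocation of sample numbers: `N l` is the least integer above
`ε⁻¹ * (∑ √(v k)) * √(v l / k l)`. -/
theorem exists_sample_allocation {v k : ℕ → ℝ} (hv : ∀ l, 0 < v l) (hk : ∀ l, 0 < k l)
    {ε : ℝ} (hε : 0 < ε) (L : ℕ) :
    ∃ N : ℕ → ℕ, (∀ l, 0 < N l) ∧ ∑ l ∈ range (L + 1), v l / N l ≤ ε ∧
      ∑ l ∈ range (L + 1), N l * k l ≤
        ε⁻¹ * (∑ l ∈ range (L + 1), √(v l * k l)) ^ 2 + ∑ l ∈ range (L + 1), k l := by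
  set S := ∑ l ∈ range (L + 1), √(v l * k l) with hS
  have hsq : ∀ l, 0 < √(v l * k l) := fun l => Real.sqrt_pos.2 (mul_pos (hv l) (hk l))
  have hSpos : 0 < S := sum_pos (fun l _ => hsq l) ⟨0, by simp⟩
  have hx : ∀ l, 0 < ε⁻¹ * S * (√(v l * k l) / k l) := fun l => by
    have := hsq l
    have := hk l
    positivity
  refine ⟨fun l => ⌈ε⁻¹ * S * (√(v l * k l) / k l)⌉₊, fun l => Nat.ceil_pos.2 (hx l), ?_, ?_⟩
  · calc ∑ l ∈ range (L + 1), v l / (⌈ε⁻¹ * S * (√(v l * k l) / k l)⌉₊ : ℝ)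
        ≤ ∑ l ∈ range (L + 1), ε / S * √(v l * k l) := by
          refine sum_le_sum fun l _ => ?_
          refine (div_le_div_of_nonneg_left (hv l).le (hx l) (Nat.le_ceil _)).trans_eq ?_
          have h1 := (hsq l).ne'
          have h2 := (hk l).ne'
          have h3 : √(v l * k l) ^ 2 = v l * k l :=
            Real.sq_sqrt (mul_pos (hv l) (hk l)).le
          field_simp
          rw [h3]
      _ = ε := by
          rw [← mul_sum, ← hS, div_mul_cancel₀ _ hSpos.ne']
  · calc ∑ l ∈ range (L + 1), (⌈ε⁻¹ * S * (√(v l * k l) / k l)⌉₊ : ℝ) * k l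
        ≤ ∑ l ∈ range (L + 1), (ε⁻¹ * S * √(v l * k l) + k l) := by
          refine sum_le_sum fun l _ => ?_
          have h2 := hk l
          refine (mul_le_mul_of_nonneg_right (Nat.ceil_lt_add_one (hx l).le).le
            h2.le).trans_eq ?_
          field_simp
      _ = ε⁻¹ * S ^ 2 + ∑ l ∈ range (L + 1), k l := by
          rw [sum_add_distrib, ← mul_sum, ← hS]
          ring

/-- The growth factor of the multilevel cost beyond `δ ^ (-2)` in the three regimes. -/
noncomputable def mlmcRate (α β γ δ : ℝ) : ℝ :=
  if γ < β then 1 else if β = γ then Real.log δ⁻¹ ^ 2 else δ ^ (-((γ - β) / α))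

theorem one_le_log_inv {δ : ℝ} (hδ : 0 < δ) (hδe : δ < Real.exp (-1)) : 1 ≤ Real.log δ⁻¹ := by
  have h := Real.log_lt_log hδ hδe
  rw [Real.log_exp] at h
  rw [Real.log_inv]
  linarith

theorem one_le_mlmcRate {α β γ δ : ℝ} (hα : 0 < α) (hδ : 0 < δ) (hδe : δ < Real.exp (-1)) :
    1 ≤ mlmcRate α β γ δ := by
  have hδ1 : δ ≤ 1 := hδe.le.trans (Real.exp_le_one_iff.2 (by norm_num))
  unfold mlmcRate
  split_ifs with h1 h2
  · exact le_rfl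
  · exact one_le_pow₀ (one_le_log_inv hδ hδe)
  · have : 0 ≤ γ - β := by linarith [not_lt.1 h1]
    exact Real.one_le_rpow_of_pos_of_le_one_of_nonpos hδ hδ1 (by
      rw [neg_nonpos]
      positivity)

theorem exists_sq_geom_sum_le_mlmcRate {q α K : ℝ} (β γ : ℝ) (hq : 1 < q) (hα : 0 < α)
    (hK : 0 < K) :
    ∃ D : ℝ, 0 < D ∧ ∀ δ : ℝ, 0 < δ → δ < Real.exp (-1) → ∀ L : ℕ, (q ^ α) ^ L ≤ K / δ →
      (∑ l ∈ range (L + 1), (q ^ ((γ - β) / 2)) ^ l) ^ 2 ≤ D * mlmcRate α β γ δ := by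
  have hq0 : 0 < q := by linarith
  set s := q ^ ((γ - β) / 2) with hs
  have hs0 : 0 < s := Real.rpow_pos_of_pos hq0 _
  rcases lt_trichotomy γ β with h | h | h
  · have hs1 : s < 1 := Real.rpow_lt_one_of_one_lt_of_neg hq (by linarith)
    have hs1' : 0 < 1 - s := by linarith
    refine ⟨((1 - s)⁻¹) ^ 2, by positivity, fun δ _ _ L _ => ?_⟩
    rw [mlmcRate, if_pos h, mul_one]
    gcongr
    rw [← tsum_geometric_of_lt_one hs0.le hs1]
    exact (summable_geometric_of_lt_one hs0.le hs1).sum_le_tsum _ fun l _ => by positivity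
  · have hr : 0 < Real.log (q ^ α) := Real.log_pos (Real.one_lt_rpow hq hα)
    refine ⟨((|Real.log K| + 1) / Real.log (q ^ α) + 1) ^ 2, by positivity,
      fun δ hδ hδe L hL => ?_⟩
    have hlog := one_le_log_inv hδ hδe
    have hs1 : s = 1 := by simp [hs, h]
    have hL' : L * Real.log (q ^ α) ≤ Real.log K + Real.log δ⁻¹ := by
      rw [← Real.log_pow, ← Real.log_mul hK.ne' (by positivity), ← div_eq_mul_inv]
      exact Real.log_le_log (by positivity) hL
    rw [mlmcRate, if_neg (by linarith), if_pos h.symm, ← mul_pow]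
    simp only [hs1, one_pow, sum_const, card_range, nsmul_eq_mul, mul_one]
    gcongr
    rw [add_mul, one_mul, div_mul_eq_mul_div]
    push_cast
    refine add_le_add ((le_div_iff₀ hr).2 (hL'.trans ?_)) hlog
    nlinarith [le_abs_self (Real.log K), abs_nonneg (Real.log K)]
  · have hs1 : 1 < s := Real.one_lt_rpow hq (by linarith)
    have hs1' : 0 < s - 1 := by linarith
    refine ⟨(s / (s - 1)) ^ 2 * K ^ ((γ - β) / α), by positivity, fun δ hδ _ L hL => ?_⟩
    rw [mlmcRate, if_neg (by linarith), if_neg h.ne]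
    have hss : (s ^ L) ^ 2 = (q ^ (γ - β)) ^ L := by
      rw [← pow_mul, mul_comm, pow_mul, hs, ← Real.rpow_natCast (q ^ ((γ - β) / 2)) 2,
        ← Real.rpow_mul hq0.le]
      norm_num
    calc (∑ l ∈ range (L + 1), s ^ l) ^ 2 ≤ (s / (s - 1) * s ^ L) ^ 2 := by
          gcongr
          exact geom_sum_le_mul_pow hs1 L
      _ = (s / (s - 1)) ^ 2 * (q ^ (γ - β)) ^ L := by rw [mul_pow, hss]
      _ ≤ (s / (s - 1)) ^ 2 * (K ^ ((γ - β) / α) * δ ^ (-((γ - β) / α))) := by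
          gcongr
          exact rpow_pow_le_of_rpow_pow_le hq0 hα (by linarith) hK hδ hL
      _ = _ := by ring

/-- The multilevel cost bound with a constant that is uniform in the variances and costs. -/
theorem exists_uniform_mlmc_cost {T q α β γ c1 c2 c3 : ℝ} (hT : 0 < T) (hq : 1 < q)
    (hα : 0 < α) (hγ : 0 < γ) (h2αγ : γ ≤ 2 * α) (hc1 : 0 < c1) (hc2 : 0 < c2)
    (hc3 : 0 < c3) :
    ∃ c4 : ℝ, 0 < c4 ∧ ∀ V C : ℕ → ℝ,
      (∀ l, V l ≤ c2 * (T * (q ^ l)⁻¹) ^ β) → (∀ l, C l ≤ c3 * (T * (q ^ l)⁻¹) ^ (-γ)) →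
      ∀ δ : ℝ, 0 < δ → δ < Real.exp (-1) → ∃ (L : ℕ) (N : ℕ → ℕ), (∀ l, 0 < N l) ∧
        c1 * (T * (q ^ L)⁻¹) ^ α ≤ δ / √2 ∧
        ∑ l ∈ range (L + 1), V l / N l ≤ δ ^ 2 / 2 ∧
        ∑ l ∈ range (L + 1), N l * C l ≤ c4 * δ ^ (-2 : ℝ) * mlmcRate α β γ δ := by
  have hq0 : 0 < q := by linarith
  have hr : 1 < q ^ α := Real.one_lt_rpow hq hα
  have hg : 1 < q ^ γ := Real.one_lt_rpow hq hγ
  have hg' : 0 < q ^ γ - 1 := by linarith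
  set M := √2 * (c1 * T ^ α) with hM
  have hMpos : 0 < M := by positivity
  set K := 1 + q ^ α * M with hKdef
  have hK : 0 < K := by positivity
  obtain ⟨D, hD, hDle⟩ := exists_sq_geom_sum_le_mlmcRate β γ hq hα hK
  set A := c2 * c3 * T ^ (β - γ) with hA
  have hApos : 0 < A := by positivity
  set E := c3 * T ^ (-γ) * (q ^ γ / (q ^ γ - 1) * K ^ (γ / α)) with hE
  have hEpos : 0 < E := by positivity
  refine ⟨2 * A * D + E, by positivity, fun V C hV hC δ hδ hδe => ?_⟩
  have hδ1 : δ < 1 := hδe.trans (Real.exp_lt_one_iff.2 (by norm_num))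
  obtain ⟨L, hL1, hL2⟩ := exists_pow_ge_and_le hr hMpos hδ hδ1
  have hmesh : ∀ l, 0 < T * (q ^ l)⁻¹ := fun l => by positivity
  obtain ⟨N, hN, hNv, hNc⟩ := exists_sample_allocation
    (v := fun l => c2 * (T * (q ^ l)⁻¹) ^ β) (k := fun l => c3 * (T * (q ^ l)⁻¹) ^ (-γ))
    (fun l => mul_pos hc2 (Real.rpow_pos_of_pos (hmesh l) _))
    (fun l => mul_pos hc3 (Real.rpow_pos_of_pos (hmesh l) _))
    (ε := δ ^ 2 / 2) (by positivity) L
  refine ⟨L, N, hN, ?_, (sum_le_sum fun l _ => ?_).trans hNv, ?_⟩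
  · rw [mesh_rpow hT hq0, Real.rpow_neg hq0.le, inv_pow, ← mul_assoc, ← div_eq_mul_inv,
      div_le_div_iff₀ (by positivity) (by positivity)]
    rw [div_le_iff₀ hδ] at hL1
    linarith
  · exact div_le_div_of_nonneg_right (hV l) (Nat.cast_nonneg _)
  · have hsum : (∑ l ∈ range (L + 1),
        √(c2 * (T * (q ^ l)⁻¹) ^ β * (c3 * (T * (q ^ l)⁻¹) ^ (-γ)))) ^ 2
        = A * (∑ l ∈ range (L + 1), (q ^ ((γ - β) / 2)) ^ l) ^ 2 := by
      have hterm : ∀ l : ℕ, √(c2 * (T * (q ^ l)⁻¹) ^ β * (c3 * (T * (q ^ l)⁻¹) ^ (-γ)))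
          = √A * (q ^ ((γ - β) / 2)) ^ l := fun l => by
        rw [mul_mul_mul_comm, ← Real.rpow_add (hmesh l), ← sub_eq_add_neg, mesh_rpow hT hq0,
          ← mul_assoc, ← hA, Real.sqrt_mul hApos.le]
        congr 1
        rw [Real.sqrt_eq_iff_mul_self_eq (by positivity) (by positivity), ← mul_pow,
          ← Real.rpow_add hq0]
        ring_nf
      simp only [hterm]
      rw [← mul_sum, mul_pow, Real.sq_sqrt hApos.le]
    have hcost : ∑ l ∈ range (L + 1), c3 * (T * (q ^ l)⁻¹) ^ (-γ) ≤ E * δ ^ (-2 : ℝ) := by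
      have hexp : δ ^ (-(γ / α)) ≤ δ ^ (-2 : ℝ) :=
        Real.rpow_le_rpow_of_exponent_ge hδ hδ1.le
          (neg_le_neg ((div_le_iff₀ hα).2 h2αγ))
      calc ∑ l ∈ range (L + 1), c3 * (T * (q ^ l)⁻¹) ^ (-γ)
          = c3 * T ^ (-γ) * ∑ l ∈ range (L + 1), (q ^ γ) ^ l := by
            simp only [mesh_rpow hT hq0, neg_neg, mul_sum, mul_assoc]
        _ ≤ c3 * T ^ (-γ) * (q ^ γ / (q ^ γ - 1) * (q ^ γ) ^ L) := by
            gcongr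
            exact geom_sum_le_mul_pow hg L
        _ ≤ c3 * T ^ (-γ) * (q ^ γ / (q ^ γ - 1) * (K ^ (γ / α) * δ ^ (-(γ / α)))) := by
            gcongr
            exact rpow_pow_le_of_rpow_pow_le hq0 hα hγ.le hK hδ hL2
        _ ≤ c3 * T ^ (-γ) * (q ^ γ / (q ^ γ - 1) * (K ^ (γ / α) * δ ^ (-2 : ℝ))) := by
            gcongr
        _ = E * δ ^ (-2 : ℝ) := by
            rw [hE]
            ring
    have hinv : (δ ^ 2 / 2)⁻¹ = 2 * δ ^ (-2 : ℝ) := by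
      rw [Real.rpow_neg hδ.le, Real.rpow_two, inv_div, div_eq_mul_inv]
    have hrate := one_le_mlmcRate (β := β) (γ := γ) hα hδ hδe
    calc ∑ l ∈ range (L + 1), N l * C l
        ≤ ∑ l ∈ range (L + 1), N l * (c3 * (T * (q ^ l)⁻¹) ^ (-γ)) :=
          sum_le_sum fun l _ => mul_le_mul_of_nonneg_left (hC l) (Nat.cast_nonneg _)
      _ ≤ _ := hNc
      _ ≤ 2 * δ ^ (-2 : ℝ) * (A * (D * mlmcRate α β γ δ)) + E * δ ^ (-2 : ℝ) := by
          rw [hsum, hinv]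
          gcongr
          exact hDle δ hδ hδe L hL2
      _ ≤ 2 * δ ^ (-2 : ℝ) * (A * (D * mlmcRate α β γ δ))
            + E * δ ^ (-2 : ℝ) * mlmcRate α β γ δ := by
          exact add_le_add_right (le_mul_of_one_le_right (by positivity) hrate) _
      _ = (2 * A * D + E) * δ ^ (-2 : ℝ) * mlmcRate α β γ δ := by ring

/-- **MLMC abstract cost bound** (Theorem 2.1 / `thm:costmlmc`).
Level `l` has time step `Δt_l = T * Γ^(-l)`, variance bound `V l ≤ c2 * Δt_l ^ β`
and per-sample cost bound `C l ≤ c3 * Δt_l ^ (-γ)`.  There is a constant `c4 > 0`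
depending only on `T, Γ, α, β, γ, c1, c2, c3` such that for every accuracy
`0 < δ < e⁻¹` one can choose a finest level `L` and positive sample numbers
`N_0, …, N_L` with (i) bias control `c1 * Δt_L ^ α ≤ δ / √2`, (ii) variance control
`∑ V l / N l ≤ δ² / 2`, and (iii) total cost `∑ N l * C l` bounded as in the theorem. -/
theorem mlmc_cost (T : ℝ) (hT : 0 < T) (Γ : ℕ) (hΓ : 2 ≤ Γ)
    (α β γ c1 c2 c3 : ℝ) (hα : 0 < α) (hβ : 0 < β) (hγ : 0 < γ)
    (h2αγ : γ ≤ 2 * α) (hc1 : 0 < c1) (hc2 : 0 < c2) (hc3 : 0 < c3)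
    (V C : ℕ → ℝ) (hVnn : ∀ l, 0 ≤ V l) (hCnn : ∀ l, 0 ≤ C l)
    (hV : ∀ l, V l ≤ c2 * (T * ((Γ : ℝ) ^ l)⁻¹) ^ β)
    (hC : ∀ l, C l ≤ c3 * (T * ((Γ : ℝ) ^ l)⁻¹) ^ (-γ)) :
    ∃ c4 : ℝ, 0 < c4 ∧
      ∀ δ : ℝ, 0 < δ → δ < Real.exp (-1) →
        ∃ (L : ℕ) (N : ℕ → ℕ),
          (∀ l ≤ L, 0 < N l) ∧
          c1 * (T * ((Γ : ℝ) ^ L)⁻¹) ^ α ≤ δ / Real.sqrt 2 ∧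
          (∑ l ∈ range (L + 1), V l / (N l : ℝ)) ≤ δ ^ 2 / 2 ∧
          ((γ < β → (∑ l ∈ range (L + 1), (N l : ℝ) * C l) ≤ c4 * δ ^ (-2 : ℝ)) ∧
           (β = γ → (∑ l ∈ range (L + 1), (N l : ℝ) * C l) ≤
              c4 * δ ^ (-2 : ℝ) * (Real.log δ⁻¹) ^ 2) ∧
           (β < γ → (∑ l ∈ range (L + 1), (N l : ℝ) * C l) ≤
              c4 * δ ^ (-2 - (γ - β) / α))) := by
  have hq : (1 : ℝ) < Γ := by exact_mod_cast hΓ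
  obtain ⟨c4, hc4, h⟩ := exists_uniform_mlmc_cost (β := β) hT hq hα hγ h2αγ hc1 hc2 hc3
  refine ⟨c4, hc4, fun δ hδ hδe => ?_⟩
  obtain ⟨L, N, hN, hbias, hvar, hcost⟩ := h V C hV hC δ hδ hδe
  refine ⟨L, N, fun l _ => hN l, hbias, hvar, fun hlt => ?_, fun heq => ?_, fun hlt => ?_⟩
  · rwa [mlmcRate, if_pos hlt, mul_one] at hcost
  · rwa [mlmcRate, if_neg heq.not_gt, if_pos heq] at hcost
  · rwa [mlmcRate, if_neg hlt.not_gt, if_neg hlt.ne, mul_assoc, ← Real.rpow_add hδ,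
      ← sub_eq_add_neg] at hcost
end

section
/- Fix integers X, M ≥ 1 and Δx > 0 with X·Δx = 2, time step Δt > 0, κ = Δt/Δx, final time T = M·Δt. Let u0 : ℝ → ℝ be 2-periodic and twice continuously differentiable with sup|u0''| = C1 < ∞. Let a_0, …, a_{M−1} be random variables with values in (0, 2] satisfying a_n·Δt ≤ Δx almost surely, and let v^M be the corresponding (random) periodic upwind solution at time T and u(x, T) = u0(x − Δt·Σ_{j<M} a_j) the (random) exact solution at time T. Then Σ_{i ∈ ZMod X} Var[ v^M_i − u(x_i, T) ]·Δx ≤ 2·((2 + 1/κ)·C1·T)²·Δt². -/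
open MeasureTheory ProbabilityTheory Finset

/-- The periodic first-order upwind scheme on the grid `ZMod X` with per-step CFL
numbers `lam n = a_n·Δt/Δx`: `v⁰ = w0`,
`v^{n+1}_i = (1 − lam n)·v^n_i + lam n·v^n_{i−1}` (indices mod `X`). -/
noncomputable def upwind {X : ℕ} (lam : ℕ → ℝ) (w0 : ZMod X → ℝ) : ℕ → ZMod X → ℝ
  | 0 => w0
  | n + 1 => fun i => (1 - lam n) * upwind lam w0 n i + lam n * upwind lam w0 n (i - 1)

/-- Convexity of `f + C/2·y²` gives the one-sided error bound for linear interpolation. -/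
theorem sub_interpolation_le {f : ℝ → ℝ} {C : ℝ} (hf : ContDiff ℝ 2 f)
    (hC : ∀ y, -C ≤ deriv (deriv f) y) {r : ℝ} (hr0 : 0 ≤ r) (hr1 : r ≤ 1) (x h : ℝ) :
    f (x - r * h) - ((1 - r) * f x + r * f (x - h)) ≤ C / 2 * (r * (1 - r) * h ^ 2) := by
  have hd : Differentiable ℝ f := hf.differentiable (by norm_num)
  have hd' : Differentiable ℝ (deriv f) :=
    ((contDiff_succ_iff_deriv (n := 1)).1 (by simpa [one_add_one_eq_two] using hf)).2.2.differentiable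
      (by norm_num)
  have h1 : ∀ y, HasDerivAt (fun y => f y + C / 2 * y ^ 2) (deriv f y + C * y) y := fun y => by
    refine ((hd y).hasDerivAt.fun_add ((hasDerivAt_pow 2 y).const_mul (C / 2))).congr_deriv ?_
    push_cast
    ring
  have h2 : ∀ y, HasDerivAt (fun y => deriv f y + C * y) (deriv (deriv f) y + C) y := fun y => by
    simpa using (hd' y).hasDerivAt.fun_add ((hasDerivAt_id' y).const_mul C)
  have hconv : ConvexOn ℝ Set.univ (fun y => f y + C / 2 * y ^ 2) := by
    have e1 : deriv (fun y => f y + C / 2 * y ^ 2) = fun y => deriv f y + C * y :=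
      funext fun y => (h1 y).deriv
    refine convexOn_univ_of_deriv2_nonneg (fun y => (h1 y).differentiableAt) ?_ fun y => ?_
    · rw [e1]
      exact fun y => (h2 y).differentiableAt
    · rw [Function.iterate_succ_apply, Function.iterate_one, e1, (h2 y).deriv]
      linarith [hC y]
  have key := hconv.2 (Set.mem_univ x) (Set.mem_univ (x - h)) (sub_nonneg.2 hr1) hr0 (by ring)
  simp only [smul_eq_mul] at key
  rw [show (1 - r) * x + r * (x - h) = x - r * h by ring] at key
  linear_combination key

theorem abs_interpolation_sub_le {f : ℝ → ℝ} {C : ℝ} (hf : ContDiff ℝ 2 f)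
    (hC : ∀ y, |deriv (deriv f) y| ≤ C) {r : ℝ} (hr0 : 0 ≤ r) (hr1 : r ≤ 1) (x h : ℝ) :
    |(1 - r) * f x + r * f (x - h) - f (x - r * h)| ≤ C / 2 * (r * (1 - r) * h ^ 2) := by
  have h1 := sub_interpolation_le hf (fun y => (abs_le.1 (hC y)).1) hr0 hr1 x h
  have h2 := sub_interpolation_le (f := fun y => -f y) (C := C) hf.neg (fun y => by
    simp only [deriv.fun_neg']
    exact neg_le_neg (abs_le.1 (hC y)).2) hr0 hr1 x h
  exact abs_le.2 ⟨by linarith, by linarith⟩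

theorem ZMod.exists_val_sub_one_eq {X : ℕ} [NeZero X] (i : ZMod X) :
    ∃ k : ℤ, ((i - 1).val : ℤ) = i.val - 1 + k * X := by
  have h : (((i - 1).val : ℤ) : ZMod X) = ((i.val - 1 : ℤ) : ZMod X) := by simp
  obtain ⟨k, hk⟩ := (ZMod.intCast_eq_intCast_iff_dvd_sub _ _ _).1 h.symm
  exact ⟨k, by linarith⟩

theorem abs_upwind_sub_exact_le {X : ℕ} [NeZero X] {Δx Δt : ℝ} (hΔx : 0 < Δx) (hΔt : 0 < Δt)
    (hXΔx : (X : ℝ) * Δx = 2) {u0 : ℝ → ℝ} {C : ℝ} (hu : ContDiff ℝ 2 u0)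
    (hper : ∀ y, u0 (y + 2) = u0 y) (hC : ∀ y, |deriv (deriv u0) y| ≤ C) {b : ℕ → ℝ} {n : ℕ}
    (hb : ∀ j < n, 0 < b j ∧ b j ≤ 2 ∧ b j * Δt ≤ Δx) (i : ZMod X) :
    |upwind (fun j => b j * Δt / Δx) (fun i => u0 (-1 + (i.val : ℝ) * Δx)) n i -
      u0 ((-1 + (i.val : ℝ) * Δx) - Δt * ∑ j ∈ range n, b j)| ≤ n * (C * Δt * Δx) := by
  induction n generalizing i with
  | zero => simp [upwind]
  | succ n ih =>
    have ih := ih fun j hj => hb j (hj.trans n.lt_succ_self)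
    obtain ⟨hb0, hb2, hcfl⟩ := hb n n.lt_succ_self
    have hC0 : 0 ≤ C := (abs_nonneg _).trans (hC 0)
    set S := ∑ j ∈ range n, b j with hS
    set r := b n * Δt / Δx with hr
    have hrx : r * Δx = b n * Δt := div_mul_cancel₀ _ hΔx.ne'
    have hr0 : 0 ≤ r := by positivity
    have hr1 : r ≤ 1 := (div_le_one hΔx).2 hcfl
    set x := -1 + (i.val : ℝ) * Δx with hx
    have hshift : u0 (-1 + ((i - 1).val : ℝ) * Δx - Δt * S) = u0 (x - Δt * S - Δx) := by
      obtain ⟨k, hk⟩ := ZMod.exists_val_sub_one_eq i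
      have hk' : ((i - 1).val : ℝ) = i.val - 1 + k * X := by exact_mod_cast hk
      rw [hk', ← (show Function.Periodic u0 2 from hper).int_mul k (x - Δt * S - Δx)]
      congr 1
      rw [hx, ← hXΔx]
      ring
    have h1 := ih i
    have h2 := ih (i - 1)
    rw [hshift] at h2
    have h3 := abs_interpolation_sub_le hu hC hr0 hr1 (x - Δt * S) Δx
    have h4 : C / 2 * (r * (1 - r) * Δx ^ 2) ≤ C * Δt * Δx := by
      have : r * (1 - r) * Δx ^ 2 ≤ 2 * Δt * Δx := by
        calc r * (1 - r) * Δx ^ 2 = b n * Δt * ((1 - r) * Δx) := by rw [← hrx]; ring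
          _ ≤ 2 * Δt * Δx := by
            gcongr
            nlinarith
      nlinarith [mul_le_mul_of_nonneg_left this hC0]
    rw [sum_range_succ, ← hS, upwind,
      show x - Δt * (S + b n) = x - Δt * S - r * Δx by rw [hrx]; ring]
    rw [abs_le] at h1 h2 h3 ⊢
    have hr1' := sub_nonneg.2 hr1
    push_cast
    constructor
    · linarith [mul_le_mul_of_nonneg_left h1.1 hr1', mul_le_mul_of_nonneg_left h2.1 hr0]
    · linarith [mul_le_mul_of_nonneg_left h1.2 hr1', mul_le_mul_of_nonneg_left h2.2 hr0]

theorem measurable_upwind {X : ℕ} {Ω : Type*} [MeasurableSpace Ω] {lam : ℕ → Ω → ℝ}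
    (hlam : ∀ n, Measurable (lam n)) (w0 : ZMod X → ℝ) (n : ℕ) (i : ZMod X) :
    Measurable fun s => upwind (fun j => lam j s) w0 n i := by
  induction n generalizing i with
  | zero => exact measurable_const
  | succ n ih =>
    exact ((measurable_const.sub (hlam n)).mul (ih i)).add ((hlam n).mul (ih (i - 1)))

/-- **Property P2 of Proposition 3.1**: for random per-step velocities `a_n` with values
in `(0,2]` satisfying the CFL condition `a_n·Δt ≤ Δx` almost surely, the grid-weighted
variance of the difference between the random upwind solution `v^M` at time `T = M·Δt`
and the random exact solution `u(x,T) = u0(x − Δt·∑_{j<M} a_j)` satisfies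
`∑_i Var[v^M_i − u(x_i,T)]·Δx ≤ 2·((2 + 1/κ)·C1·T)²·Δt²`. -/
theorem variance_upwind_minus_exact (X M : ℕ) [NeZero X] (hM : 1 ≤ M)
    (Δx Δt κ T : ℝ) (hΔx : 0 < Δx) (hΔt : 0 < Δt)
    (hXΔx : (X : ℝ) * Δx = 2) (hκ : κ = Δt / Δx) (hT : T = (M : ℝ) * Δt)
    (u0 : ℝ → ℝ) (C1 : ℝ) (hsmooth : ContDiff ℝ 2 u0)
    (hper : ∀ y, u0 (y + 2) = u0 y) (hC1 : ∀ y, |deriv (deriv u0) y| ≤ C1)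
    (Ω : Type*) [MeasurableSpace Ω] (P : Measure Ω) [IsProbabilityMeasure P]
    (a : ℕ → Ω → ℝ) (hmeas : ∀ n, Measurable (a n))
    (ha : ∀ n < M, ∀ᵐ s ∂P, 0 < a n s ∧ a n s ≤ 2 ∧ a n s * Δt ≤ Δx) :
    (∑ i : ZMod X,
        variance (fun s =>
          upwind (fun n => a n s * Δt / Δx) (fun i => u0 (-1 + (i.val : ℝ) * Δx)) M i -
            u0 ((-1 + (i.val : ℝ) * Δx) - Δt * ∑ j ∈ range M, a j s)) P * Δx) ≤
      2 * ((2 + 1 / κ) * C1 * T) ^ 2 * Δt ^ 2 := by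
  have hC0 : 0 ≤ C1 := (abs_nonneg _).trans (hC1 0)
  have hvar : ∀ i : ZMod X,
      variance (fun s =>
        upwind (fun n => a n s * Δt / Δx) (fun i => u0 (-1 + (i.val : ℝ) * Δx)) M i -
          u0 ((-1 + (i.val : ℝ) * Δx) - Δt * ∑ j ∈ range M, a j s)) P ≤
        (M * (C1 * Δt * Δx)) ^ 2 := by
    intro i
    have hcont : Continuous u0 := hsmooth.continuous
    have hsum : Measurable fun s => ∑ j ∈ range M, a j s :=
      Finset.measurable_fun_sum _ fun j _ => hmeas j
    have hm := (measurable_upwind (fun n => ((hmeas n).mul_const Δt).div_const Δx)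
      (fun i : ZMod X => u0 (-1 + (i.val : ℝ) * Δx)) M i).sub
      (hcont.measurable.comp ((hsum.const_mul Δt).const_sub (-1 + (i.val : ℝ) * Δx)))
    have hae : ∀ᵐ s ∂P, ∀ n < M, 0 < a n s ∧ a n s ≤ 2 ∧ a n s * Δt ≤ Δx :=
      ae_all_iff.2 fun n => ae_all_iff.2 (ha n)
    have h := variance_le_sq_of_bounded (a := -(M * (C1 * Δt * Δx))) (b := M * (C1 * Δt * Δx))
      (hae.mono fun s hs => abs_le.1
        (abs_upwind_sub_exact_le hΔx hΔt hXΔx hsmooth hper hC1 hs i)) hm.aemeasurable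
    refine h.trans_eq ?_
    ring
  calc _ ≤ ∑ _i : ZMod X, (M * (C1 * Δt * Δx)) ^ 2 * Δx :=
        sum_le_sum fun i _ => mul_le_mul_of_nonneg_right (hvar i) hΔx.le
    _ = 2 * (1 / κ * C1 * T) ^ 2 * Δt ^ 2 := by
        rw [sum_const, card_univ, ZMod.card, nsmul_eq_mul, ← hXΔx, hκ, hT]
        field_simp
    _ ≤ _ := by
        have hκ0 : 0 < κ := hκ ▸ div_pos hΔt hΔx
        have hT0 : 0 ≤ T := by rw [hT]; positivity
        gcongr
        linarith
end

section
/- In the Jin–Xin split scheme setup, let (u^n, v^n) be the iterates obtained by applying the one-step map n times to initial data (u^0, v^0), and let E_n = E(u^n, v^n) = Σ_i [(a−b²)(u^n_i)² + (b·u^n_i − v^n_i)²]·Δx. Then E_n is monotonically non-increasing: E_n ≤ E_{n−1} ≤ … ≤ E_0 for all n ≥ 1. Moreover, if a > b², then for all n: √(Σ_i (u^n_i)²·Δx) ≤ √(E_0/(a−b²)) and √(Σ_i (v^n_i)²·Δx) ≤ √(2a·E_0/(a−b²)). -/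
/-- Convection step of the Jin–Xin split scheme on the periodic grid `ZMod X`,
in characteristic variables `ρ = √a·u + v`, `l = √a·u − v`:
`ρ*_i = (1−ν)ρ_i + νρ_{i−1}`, `l*_i = (1−ν)l_i + νl_{i+1}`,
`u* = (ρ* + l*)/(2√a)`, `v* = (ρ* − l*)/2`. -/
noncomputable def jxConv {X : ℕ} (a ν : ℝ) (w : (ZMod X → ℝ) × (ZMod X → ℝ)) :
    (ZMod X → ℝ) × (ZMod X → ℝ) :=
  let ρ : ZMod X → ℝ := fun i => Real.sqrt a * w.1 i + w.2 i
  let l : ZMod X → ℝ := fun i => Real.sqrt a * w.1 i - w.2 i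
  let ρs : ZMod X → ℝ := fun i => (1 - ν) * ρ i + ν * ρ (i - 1)
  let ls : ZMod X → ℝ := fun i => (1 - ν) * l i + ν * l (i + 1)
  (fun i => (ρs i + ls i) / (2 * Real.sqrt a), fun i => (ρs i - ls i) / 2)

/-- One full step of the deterministic Jin–Xin split scheme: convection step followed
by the relaxation step `u' = u*`, `v' = p·v* + (1−p)·b·u*`. -/
noncomputable def jxStep {X : ℕ} (a b ν p : ℝ) (w : (ZMod X → ℝ) × (ZMod X → ℝ)) :
    (ZMod X → ℝ) × (ZMod X → ℝ) :=
  let ws := jxConv a ν w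
  (ws.1, fun i => p * ws.2 i + (1 - p) * (b * ws.1 i))

/-- Discrete energy `E(u,v) = ∑_i [(a−b²)u_i² + (b·u_i − v_i)²]·Δx`. -/
noncomputable def jxEnergy {X : ℕ} [NeZero X] (a b Δx : ℝ)
    (w : (ZMod X → ℝ) × (ZMod X → ℝ)) : ℝ :=
  ∑ i : ZMod X, ((a - b ^ 2) * (w.1 i) ^ 2 + (b * w.1 i - w.2 i) ^ 2) * Δx

theorem sum_sq_convexComb_le {ι : Type*} [Fintype ι] {ν : ℝ} (h0 : 0 ≤ ν) (h1 : ν ≤ 1)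
    (f : ι → ℝ) (σ : ι ≃ ι) :
    ∑ i, ((1 - ν) * f i + ν * f (σ i)) ^ 2 ≤ ∑ i, f i ^ 2 := by
  calc ∑ i, ((1 - ν) * f i + ν * f (σ i)) ^ 2
      ≤ ∑ i, ((1 - ν) * f i ^ 2 + ν * f (σ i) ^ 2) := by
        refine Finset.sum_le_sum fun i _ => ?_
        nlinarith [mul_nonneg (mul_nonneg h0 (sub_nonneg.2 h1)) (sq_nonneg (f i - f (σ i)))]
    _ = ∑ i, f i ^ 2 := by
        rw [Finset.sum_add_distrib, ← Finset.mul_sum, ← Finset.mul_sum,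
          Equiv.sum_comp σ fun i => f i ^ 2]
        ring

/-- The energy is diagonal in the characteristic variables. -/
theorem jxEnergy_eq_characteristic {X : ℕ} [NeZero X] {a : ℝ} (ha : 0 < a) (b Δx : ℝ)
    (w : (ZMod X → ℝ) × (ZMod X → ℝ)) :
    jxEnergy a b Δx w =
      ((1 - b / √a) / 2 * ∑ i, (√a * w.1 i + w.2 i) ^ 2 +
        (1 + b / √a) / 2 * ∑ i, (√a * w.1 i - w.2 i) ^ 2) * Δx := by
  have hs : √a ≠ 0 := (Real.sqrt_pos.2 ha).ne'
  rw [jxEnergy, ← Finset.sum_mul, Finset.mul_sum, Finset.mul_sum, ← Finset.sum_add_distrib]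
  congr 1
  refine Finset.sum_congr rfl fun i _ => ?_
  have hsq : a = √a ^ 2 := (Real.sq_sqrt ha.le).symm
  generalize √a = s at *
  subst hsq
  field_simp
  ring

theorem jxEnergy_jxConv_le {X : ℕ} [NeZero X] {a b ν Δx : ℝ} (hΔx : 0 ≤ Δx) (ha : 0 < a)
    (hab : b ^ 2 ≤ a) (h0 : 0 ≤ ν) (h1 : ν ≤ 1) (w : (ZMod X → ℝ) × (ZMod X → ℝ)) :
    jxEnergy a b Δx (jxConv a ν w) ≤ jxEnergy a b Δx w := by
  have hs : 0 < √a := Real.sqrt_pos.2 ha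
  obtain ⟨hb1, hb2⟩ := abs_le.1 (Real.abs_le_sqrt hab)
  have hc1 : 0 ≤ (1 - b / √a) / 2 := by
    have := (div_le_one hs).2 hb2
    linarith
  have hc2 : 0 ≤ (1 + b / √a) / 2 := by
    have := (le_div_iff₀ hs).2 (by linarith : -1 * √a ≤ b)
    linarith
  have hρ : ∀ i, √a * (jxConv a ν w).1 i + (jxConv a ν w).2 i =
      (1 - ν) * (√a * w.1 i + w.2 i) + ν * (√a * w.1 (i - 1) + w.2 (i - 1)) := by
    intro i
    simp only [jxConv]
    field_simp
    ring
  have hl : ∀ i, √a * (jxConv a ν w).1 i - (jxConv a ν w).2 i =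
      (1 - ν) * (√a * w.1 i - w.2 i) + ν * (√a * w.1 (i + 1) - w.2 (i + 1)) := by
    intro i
    simp only [jxConv]
    field_simp
    ring
  rw [jxEnergy_eq_characteristic ha, jxEnergy_eq_characteristic ha]
  simp only [hρ, hl]
  gcongr ((1 - b / √a) / 2 * ?_ + (1 + b / √a) / 2 * ?_) * Δx
  · exact sum_sq_convexComb_le h0 h1 (fun i => √a * w.1 i + w.2 i) (Equiv.subRight 1)
  · exact sum_sq_convexComb_le h0 h1 (fun i => √a * w.1 i - w.2 i) (Equiv.addRight 1)

theorem jxEnergy_jxStep_le_jxConv {X : ℕ} [NeZero X] {a b ν p Δx : ℝ} (hΔx : 0 ≤ Δx)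
    (h0 : 0 ≤ p) (h1 : p ≤ 1) (w : (ZMod X → ℝ) × (ZMod X → ℝ)) :
    jxEnergy a b Δx (jxStep a b ν p w) ≤ jxEnergy a b Δx (jxConv a ν w) := by
  refine Finset.sum_le_sum fun i _ => mul_le_mul_of_nonneg_right ?_ hΔx
  have h : b * (jxStep a b ν p w).1 i - (jxStep a b ν p w).2 i =
      p * (b * (jxConv a ν w).1 i - (jxConv a ν w).2 i) := by
    simp only [jxStep]
    ring
  rw [h, mul_pow]
  exact add_le_add le_rfl (mul_le_of_le_one_left (sq_nonneg _) (pow_le_one₀ h0 h1))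

theorem sum_fst_sq_le_jxEnergy_div {X : ℕ} [NeZero X] {a b Δx : ℝ} (hΔx : 0 ≤ Δx)
    (hab : b ^ 2 < a) (w : (ZMod X → ℝ) × (ZMod X → ℝ)) :
    ∑ i, w.1 i ^ 2 * Δx ≤ jxEnergy a b Δx w / (a - b ^ 2) := by
  rw [le_div_iff₀ (sub_pos.2 hab), jxEnergy, Finset.sum_mul]
  refine Finset.sum_le_sum fun i _ => ?_
  nlinarith [mul_nonneg (sq_nonneg (b * w.1 i - w.2 i)) hΔx]

theorem sum_snd_sq_le_jxEnergy_div {X : ℕ} [NeZero X] {a b Δx : ℝ} (hΔx : 0 ≤ Δx)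
    (hab : b ^ 2 < a) (w : (ZMod X → ℝ) × (ZMod X → ℝ)) :
    ∑ i, w.2 i ^ 2 * Δx ≤ 2 * a * jxEnergy a b Δx w / (a - b ^ 2) := by
  rw [le_div_iff₀ (sub_pos.2 hab), jxEnergy, Finset.sum_mul, Finset.mul_sum]
  refine Finset.sum_le_sum fun i _ => ?_
  have h1 := mul_nonneg (sq_nonneg (a * w.1 i - b * w.2 i)) hΔx
  have h2 := mul_nonneg (mul_nonneg (sub_pos.2 hab).le (sq_nonneg (w.2 i))) hΔx
  linear_combination 2 * h1 + h2

/-- **Energy decay and boundedness for the deterministic Jin–Xin split scheme**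
(Lemma 5.1 / `thm:det-energy`): the discrete energy of the iterates is monotonically
non-increasing, and if `a > b²` the discrete `ℓ²` norms of `u^n` and `v^n` stay bounded
by `√(E₀/(a−b²))` and `√(2aE₀/(a−b²))` respectively. -/
theorem jx_energy_decay (X : ℕ) [NeZero X] (Δx : ℝ) (hΔx : 0 < Δx)
    (a b ν p : ℝ) (ha : 0 < a) (hab : b ^ 2 ≤ a)
    (hν : ν ∈ Set.Ioc (0 : ℝ) 1) (hp : p ∈ Set.Ico (0 : ℝ) 1)
    (u0 v0 : ZMod X → ℝ) :
    (Antitone fun n => jxEnergy a b Δx ((jxStep a b ν p)^[n] (u0, v0))) ∧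
    (b ^ 2 < a → ∀ n : ℕ,
      Real.sqrt (∑ i : ZMod X, (((jxStep a b ν p)^[n] (u0, v0)).1 i) ^ 2 * Δx) ≤
        Real.sqrt (jxEnergy a b Δx (u0, v0) / (a - b ^ 2)) ∧
      Real.sqrt (∑ i : ZMod X, (((jxStep a b ν p)^[n] (u0, v0)).2 i) ^ 2 * Δx) ≤
        Real.sqrt (2 * a * jxEnergy a b Δx (u0, v0) / (a - b ^ 2))) := by
  have hanti : Antitone fun n => jxEnergy a b Δx ((jxStep a b ν p)^[n] (u0, v0)) := by
    refine antitone_nat_of_succ_le fun n => ?_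
    rw [Function.iterate_succ_apply']
    exact (jxEnergy_jxStep_le_jxConv hΔx.le hp.1 hp.2.le _).trans
      (jxEnergy_jxConv_le hΔx.le ha hab hν.1.le hν.2 _)
  refine ⟨hanti, fun hlt n => ?_⟩
  have hE : jxEnergy a b Δx ((jxStep a b ν p)^[n] (u0, v0)) ≤ jxEnergy a b Δx (u0, v0) := by
    simpa only [Function.iterate_zero, id_eq] using hanti (Nat.zero_le n)
  generalize (jxStep a b ν p)^[n] (u0, v0) = w at hE ⊢
  have hd : 0 ≤ a - b ^ 2 := (sub_pos.2 hlt).le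
  exact ⟨Real.sqrt_le_sqrt ((sum_fst_sq_le_jxEnergy_div hΔx.le hlt _).trans (by gcongr)),
    Real.sqrt_le_sqrt ((sum_snd_sq_le_jxEnergy_div hΔx.le hlt _).trans (by gcongr))⟩
end

section
/- In the Jin–Xin split scheme setup, the deterministic convection step does not increase the discrete energy: for all grid functions u, v : ZMod X → ℝ, with (u*, v*) the result of the convection step applied to (u, v), one has E(u*, v*) ≤ E(u, v), where E(u,v) = Σ_{i}[(a−b²)·u_i² + (b·u_i − v_i)²]·Δx; more precisely E(u*, v*) = [(1−ν)² + ν²]·E(u,v) + 2ν(1−ν)·Σ_i[(a−b²)·u_i·u_{i+1} + (b·u_i − v_i)·(b·u_{i+1} − v_{i+1})]·Δx, and the cross term is bounded by E(u,v) via the Cauchy–Schwarz inequality. -/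
/-- A function and its shift by one have the same sum over the periodic grid. -/
theorem ZMod.sum_shift_one {X : ℕ} [NeZero X] (f : ZMod X → ℝ) :
    ∑ i, f (i + 1) = ∑ i, f i :=
  Equiv.sum_comp (Equiv.addRight (1 : ZMod X)) f

/-- Energy identity for the convection step. The energy density is diagonal in the characteristic
variables, so the two sides agree pointwise up to discrete derivatives. -/
theorem jxEnergy_jxConv {X : ℕ} [NeZero X] (a b ν Δx : ℝ) (ha : 0 < a) (u v : ZMod X → ℝ) :
    jxEnergy a b Δx (jxConv a ν (u, v)) =
      ((1 - ν) ^ 2 + ν ^ 2) * jxEnergy a b Δx (u, v) +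
        2 * ν * (1 - ν) *
          ∑ i : ZMod X,
            ((a - b ^ 2) * (u i * u (i + 1)) +
              (b * u i - v i) * (b * u (i + 1) - v (i + 1))) * Δx := by
  obtain ⟨s, hs, rfl⟩ : ∃ s : ℝ, 0 < s ∧ a = s ^ 2 :=
    ⟨√a, Real.sqrt_pos.2 ha, (Real.sq_sqrt ha.le).symm⟩
  let F : ZMod X → ℝ := fun i =>
    (1 / 2 - b / (2 * s)) * (ν ^ 2 * (s * u i + v i) ^ 2 +
      2 * ν * (1 - ν) * ((s * u i + v i) * (s * u (i + 1) + v (i + 1)))) * Δx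
  let G : ZMod X → ℝ := fun i =>
    (1 / 2 + b / (2 * s)) * ν ^ 2 * (s * u i - v i) ^ 2 * Δx
  have hF : ∑ i, F (i - 1) = ∑ i, F i := Equiv.sum_comp (Equiv.subRight (1 : ZMod X)) F
  have hG : ∑ i, G (i + 1) = ∑ i, G i := ZMod.sum_shift_one G
  rw [← sub_eq_zero]
  calc
    _ = ∑ i, ((F (i - 1) - F i) + (G (i + 1) - G i)) := by
      simp only [jxEnergy, jxConv, Real.sqrt_sq hs.le, Finset.mul_sum, ← Finset.sum_add_distrib,
        ← Finset.sum_sub_distrib]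
      refine Finset.sum_congr rfl fun i _ => ?_
      simp only [F, G, sub_add_cancel]
      field_simp
      ring
    _ = 0 := by
      rw [Finset.sum_add_distrib, Finset.sum_sub_distrib, Finset.sum_sub_distrib, hF, hG]
      ring

/-- The correlation of a state with its shift by one is at most its energy. -/
theorem sum_shift_mul_le_jxEnergy {X : ℕ} [NeZero X] {a b Δx : ℝ} (hΔx : 0 ≤ Δx)
    (hab : b ^ 2 ≤ a) (u v : ZMod X → ℝ) :
    ∑ i : ZMod X,
      ((a - b ^ 2) * (u i * u (i + 1)) +
        (b * u i - v i) * (b * u (i + 1) - v (i + 1))) * Δx ≤ jxEnergy a b Δx (u, v) := by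
  let e : ZMod X → ℝ := fun i => ((a - b ^ 2) * u i ^ 2 + (b * u i - v i) ^ 2) * Δx
  calc
    _ ≤ ∑ i, (e i + e (i + 1)) / 2 := by
      refine Finset.sum_le_sum fun i _ => ?_
      have h : 0 ≤ ((a - b ^ 2) * (u i - u (i + 1)) ^ 2 +
          ((b * u i - v i) - (b * u (i + 1) - v (i + 1))) ^ 2) * Δx := by
        have := sub_nonneg.2 hab
        positivity
      simp only [e]
      linarith
    _ = ∑ i, e i := by
      rw [← Finset.sum_div, Finset.sum_add_distrib, ZMod.sum_shift_one]
      ring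

/-- **Energy identity and decay for the convection step of the Jin–Xin split scheme**
(equation (E.3) / `det:energy-h-step`): the convection step satisfies
`E(u*,v*) = [(1−ν)² + ν²]·E(u,v) + 2ν(1−ν)·(cross term)`, and `E(u*,v*) ≤ E(u,v)`. -/
theorem jx_conv_energy (X : ℕ) [NeZero X] (Δx : ℝ) (hΔx : 0 < Δx)
    (a b ν : ℝ) (ha : 0 < a) (hab : b ^ 2 ≤ a) (hν0 : 0 ≤ ν) (hν1 : ν ≤ 1)
    (u v : ZMod X → ℝ) :
    jxEnergy a b Δx (jxConv a ν (u, v)) =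
      ((1 - ν) ^ 2 + ν ^ 2) * jxEnergy a b Δx (u, v) +
        2 * ν * (1 - ν) *
          ∑ i : ZMod X,
            ((a - b ^ 2) * (u i * u (i + 1)) +
              (b * u i - v i) * (b * u (i + 1) - v (i + 1))) * Δx ∧
    jxEnergy a b Δx (jxConv a ν (u, v)) ≤ jxEnergy a b Δx (u, v) := by
  refine ⟨jxEnergy_jxConv a b ν Δx ha u v, ?_⟩
  rw [jxEnergy_jxConv a b ν Δx ha u v]
  have hν : 0 ≤ 2 * ν * (1 - ν) := mul_nonneg (by positivity) (sub_nonneg.2 hν1)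
  linarith [mul_le_mul_of_nonneg_left (sum_shift_mul_le_jxEnergy hΔx.le hab u v) hν]
end
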